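/- If n, m, a are nonnegative integers with n > m, n > 200, and L_n + L_m = 3^a, then α^{n−m} < 7·163·a < 1.3692×10^{23}, and consequently n − m ≤ 110. -/

import Mathlib

/-- The Lucas sequence: `L 0 = 2`, `L 1 = 1`, `L (n+2) = L (n+1) + L n`. -/
def lucas : ℕ → ℕ
  | 0 => 2
  | 1 => 1
  | n + 2 => lucas (n + 1) + lucas n

/-- The golden ratio `α = (1 + √5)/2`. -/
noncomputable def α : ℝ := (1 + Real.sqrt 5) / 2

theorem lucas_rec (n : ℕ) : lucas (n + 2) = lucas (n + 1) + lucas n := rfl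

/-- Binet's formula. -/
theorem lucas_binet (n : ℕ) :
    (lucas n : ℝ) = Real.goldenRatio ^ n + Real.goldenConj ^ n := by
  induction n using Nat.strong_induction_on with
  | _ n ih =>
    match n with
    | 0 => norm_num [lucas]
    | 1 => simp [lucas, Real.goldenRatio_add_goldenConj]
    | n + 2 =>
      rw [lucas_rec, Nat.cast_add, ih (n + 1) (by omega), ih n (by omega)]
      rw [pow_add _ n 2, pow_add _ n 2, Real.goldenRatio_sq, Real.goldenConj_sq]
      ring

/-- If the difference of indices is divisible by 4, the sum factors. -/
theorem lucas_factor (m j : ℕ) :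
    lucas (m + 4 * j) + lucas m = lucas (m + 2 * j) * lucas (2 * j) := by
  have key : Real.goldenRatio ^ (2 * j) * Real.goldenConj ^ (2 * j) = 1 := by
    rw [← mul_pow, Real.goldenRatio_mul_goldenConj, pow_mul]
    norm_num
  have : ((lucas (m + 4 * j) + lucas m : ℕ) : ℝ)
      = ((lucas (m + 2 * j) * lucas (2 * j) : ℕ) : ℝ) := by
    push_cast
    simp only [lucas_binet]
    have e : m + 4 * j = m + 2 * j + 2 * j := by ring
    rw [e]
    simp only [pow_add _ _ (2 * j)]
    linear_combination (-(Real.goldenRatio ^ m) - Real.goldenConj ^ m) * key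
  exact_mod_cast this

theorem lucas_period_step (n : ℕ) : lucas (n + 24) % 720 = lucas n % 720 := by
  induction n using Nat.strong_induction_on with
  | _ n ih =>
    match n with
    | 0 => decide +kernel
    | 1 => decide +kernel
    | n + 2 =>
      have h1 := ih (n + 1) (by omega)
      have h2 := ih n (by omega)
      have e : lucas (n + 2 + 24) = lucas (n + 1 + 24) + lucas (n + 24) := rfl
      have e2 := lucas_rec n
      omega

theorem lucas_period (n : ℕ) : lucas n % 720 = lucas (n % 24) % 720 := by
  induction n using Nat.strong_induction_on with
  | _ n ih =>
    by_cases hn : n < 24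
    · rw [Nat.mod_eq_of_lt hn]
    · obtain ⟨k, rfl⟩ : ∃ k, n = k + 24 := ⟨n - 24, by omega⟩
      rw [lucas_period_step, ih k (by omega), Nat.add_mod_right]

theorem le_lucas (n : ℕ) : n ≤ lucas n ∧ 1 ≤ lucas n := by
  induction n using Nat.strong_induction_on with
  | _ n ih =>
    match n with
    | 0 => decide
    | 1 => decide
    | n + 2 =>
      have h1 := ih (n + 1) (by omega)
      have h2 := ih n (by omega)
      rw [lucas_rec]
      omega

theorem three_pow_mod (a : ℕ) (ha : 2 ≤ a) :
    3 ^ a % 720 = 9 ∨ 3 ^ a % 720 = 27 ∨ 3 ^ a % 720 = 81 ∨ 3 ^ a % 720 = 243 := by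
  induction a, ha using Nat.le_induction with
  | base => norm_num
  | succ k hk ih =>
    rw [pow_succ]
    omega

theorem two_le_exp (x a : ℕ) (hx : 4 ≤ x) (h : x = 3 ^ a) : 2 ≤ a := by
  by_contra hc
  have : a = 0 ∨ a = 1 := by omega
  rcases this with rfl | rfl <;> omega

theorem check_pair : ∀ x < 24, ∀ y < 24, x % 4 ≠ y % 4 →
    (lucas x + lucas y) % 720 ≠ 9 ∧ (lucas x + lucas y) % 720 ≠ 27 ∧
    (lucas x + lucas y) % 720 ≠ 81 ∧ (lucas x + lucas y) % 720 ≠ 243 := by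
  decide +kernel

theorem check_single : ∀ x < 24,
    lucas x % 720 ≠ 9 ∧ lucas x % 720 ≠ 27 ∧
    lucas x % 720 ≠ 81 ∧ lucas x % 720 ≠ 243 := by
  decide +kernel

/-- There are in fact no solutions with `n > 200`. -/
theorem no_solution (n m a : ℕ) (hnm : m < n) (hn : 200 < n)
    (h : lucas n + lucas m = 3 ^ a) : False := by
  by_cases h4 : n % 4 = m % 4
  · obtain ⟨j, rfl⟩ : ∃ j, n = m + 4 * j := ⟨(n - m) / 4, by omega⟩
    rw [lucas_factor] at h
    have hd : lucas (m + 2 * j) ∣ 3 ^ a := ⟨_, h.symm⟩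
    obtain ⟨b, -, hb⟩ := (Nat.dvd_prime_pow Nat.prime_three).1 hd
    have hl := (le_lucas (m + 2 * j)).1
    have hb2 := two_le_exp _ b (by omega) hb
    have h1 := three_pow_mod b hb2
    have h2 := check_single ((m + 2 * j) % 24) (Nat.mod_lt _ (by norm_num))
    rw [← lucas_period, hb] at h2
    omega
  · have hl := (le_lucas n).1
    have ha2 := two_le_exp _ a (by omega) h
    have h1 := three_pow_mod a ha2
    have h2 := check_pair (n % 24) (Nat.mod_lt _ (by norm_num)) (m % 24)
      (Nat.mod_lt _ (by norm_num)) (by omega)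
    have hp := lucas_period n
    have hq := lucas_period m
    rw [← h] at h1
    omega

/-- If `n > m`, `n > 200` and `L n + L m = 3^a`, then
`α^(n−m) < 7·163·a < 1.3692×10²³` and consequently `n − m ≤ 110`. -/
theorem n_sub_m_le (n m a : ℕ) (hnm : m < n) (hn : 200 < n)
    (h : lucas n + lucas m = 3 ^ a) :
    α ^ (n - m) < 7 * 163 * (a : ℝ) ∧
    7 * 163 * (a : ℝ) < 1.3692e23 ∧
    n - m ≤ 110 :=
  (no_solution n m a hnm hn h).elim
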